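/- Let λ > 0 and λ₁, μ, μ₁ ∈ ℝ with α = λ₁/λ ≠ -1. Assume c₁ < 0 and c₂ < 0 (i.e., (α,δ,σ) ∈ U(-,-)). Then: if |δ| ≤ 1, the discrete spectrum s_d(H) consists of exactly two distinct real numbers ν₁ ∈ (-∞, 0) and ν₂ ∈ (4λ, ∞); if |δ| > 1, the discrete spectrum s_d(H) consists of exactly three distinct real numbers ν₁ ∈ (-∞, 0), ν₂ ∈ (4λ, ∞) and ν₃ = κ. -/

import Mathlib

/-- The Hamiltonian `H = H₀ + H₁` acting on complex sequences `f : ℤ → ℂ`. -/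
noncomputable def Hop (lam lam1 mu mu1 : ℝ) (f : ℤ → ℂ) : ℤ → ℂ := fun n =>
  if n = 0 then -((lam : ℂ) + (lam1 : ℂ)) * (f 1 - 2 * f 0 + f (-1)) + (mu : ℂ) * f 0
  else if n = 1 then -(lam : ℂ) * (f 2 - 2 * f 1 + f 0) - (lam1 : ℂ) * f 0 + (mu1 : ℂ) * f 1
  else if n = -1 then
    -(lam : ℂ) * (f 0 - 2 * f (-1) + f (-2)) - (lam1 : ℂ) * f 0 + (mu1 : ℂ) * f (-1)
  else -(lam : ℂ) * (f (n + 1) - 2 * f n + f (n - 1))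

/-- `ν` is an eigenvalue of `H`: there is a nonzero square-summable `f` with `Hf = νf`. -/
noncomputable def IsEigenvalue (lam lam1 mu mu1 ν : ℝ) : Prop :=
  ∃ f : ℤ → ℂ, f ≠ 0 ∧ Summable (fun n : ℤ => ‖f n‖ ^ 2) ∧
    ∀ n : ℤ, Hop lam lam1 mu mu1 f n = (ν : ℂ) * f n

/-- The discrete spectrum `s_d(H)`: real eigenvalues outside `[0, 4λ]`. -/
noncomputable def discSpec (lam lam1 mu mu1 : ℝ) : Set ℝ :=
  {ν : ℝ | IsEigenvalue lam lam1 mu mu1 ν ∧ ν ∉ Set.Icc 0 (4 * lam)}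

open Filter Topology

/-- In the variable `s`, with `ν = λ (2 - s)`, the eigenvalue equation splits into the three
equations at `0`, `1`, `-1` and a constant-coefficient recurrence on each half-line. -/
lemma hop_eq_iff {lam : ℝ} (hlam : lam ≠ 0) (al de si s : ℝ) (f : ℤ → ℂ) :
    (∀ n : ℤ, Hop lam (al * lam) (2 * lam * (si - al)) (de * lam) f n
      = ((lam * (2 - s) : ℝ) : ℂ) * f n) ↔
    (1 + al : ℂ) * (f 1 + f (-1)) = (2 * si + s) * f 0 ∧
    (1 + al : ℂ) * f 0 + f 2 = (de + s) * f 1 ∧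
    (1 + al : ℂ) * f 0 + f (-2) = (de + s) * f (-1) ∧
    (∀ k : ℕ, f (k + 3) + f (k + 1) = s * f (k + 2)) ∧
    (∀ k : ℕ, f (-(k + 3)) + f (-(k + 1)) = s * f (-(k + 2))) := by
  have hl : (lam : ℂ) ≠ 0 := by exact_mod_cast hlam
  constructor
  · intro h
    refine ⟨?_, ?_, ?_, fun k => ?_, fun k => ?_⟩
    · have := h 0
      simp only [Hop, if_true] at this
      push_cast at this
      apply mul_left_cancel₀ hl
      linear_combination -this
    · have := h 1
      simp only [Hop, one_ne_zero, if_true, if_false] at this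
      push_cast at this
      apply mul_left_cancel₀ hl
      linear_combination -this
    · have := h (-1)
      have e1 : ¬ ((-1 : ℤ) = 0) := by norm_num
      have e2 : ¬ ((-1 : ℤ) = 1) := by norm_num
      simp only [Hop, e1, e2, if_true, if_false] at this
      push_cast at this
      apply mul_left_cancel₀ hl
      linear_combination -this
    · have := h (k + 2)
      rw [Hop, if_neg (by omega), if_neg (by omega), if_neg (by omega),
        show (k + 2 + 1 : ℤ) = k + 3 by ring, show (k + 2 - 1 : ℤ) = k + 1 by ring] at this
      push_cast at this
      apply mul_left_cancel₀ hl
      linear_combination -this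
    · have := h (-(k + 2))
      rw [Hop, if_neg (by omega), if_neg (by omega), if_neg (by omega),
        show (-(k + 2) + 1 : ℤ) = -(k + 1) by ring,
        show (-(k + 2) - 1 : ℤ) = -(k + 3) by ring] at this
      push_cast at this
      apply mul_left_cancel₀ hl
      linear_combination -this
  · rintro ⟨h0, h1, h2, h3, h4⟩ n
    unfold Hop
    split_ifs with c0 c1 c2
    · subst c0
      push_cast
      linear_combination -(lam : ℂ) * h0
    · subst c1
      push_cast
      linear_combination -(lam : ℂ) * h1
    · subst c2
      push_cast
      linear_combination -(lam : ℂ) * h2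
    · rcases lt_or_gt_of_ne c0 with hn | hn
      · obtain ⟨k, rfl⟩ : ∃ k : ℕ, n = -(k + 2) := ⟨(-n - 2).toNat, by omega⟩
        rw [show (-(k + 2) + 1 : ℤ) = -(k + 1) by ring,
          show (-(k + 2) - 1 : ℤ) = -(k + 3) by ring]
        push_cast
        linear_combination -(lam : ℂ) * h4 k
      · obtain ⟨k, rfl⟩ : ∃ k : ℕ, n = k + 2 := ⟨(n - 2).toNat, by omega⟩
        rw [show (k + 2 + 1 : ℤ) = k + 3 by ring, show (k + 2 - 1 : ℤ) = k + 1 by ring]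
        push_cast
        linear_combination -(lam : ℂ) * h3 k

/-- A null sequence solving `u (k + 2) + u k = (t + t⁻¹) u (k + 1)` with `0 < |t| < 1` is
geometric of ratio `t`. -/
lemma eq_pow_mul_of_recurrence {t : ℝ} (ht0 : t ≠ 0) (ht1 : |t| < 1) {u : ℕ → ℂ}
    (hu : ∀ k, u (k + 2) + u k = ((t + t⁻¹ : ℝ) : ℂ) * u (k + 1))
    (hlim : Tendsto u atTop (𝓝 0)) (k : ℕ) : u k = (t : ℂ) ^ k * u 0 := by
  have htc : (t : ℂ) ≠ 0 := by exact_mod_cast ht0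
  have hv : ∀ k, (t : ℂ) ^ k * (u (k + 1) - t * u k) = u 1 - t * u 0 := by
    intro k
    induction k with
    | zero => simp
    | succ k ih =>
      rw [← ih]
      have := hu k
      push_cast at this
      have e : (t : ℂ) * (t : ℂ)⁻¹ = 1 := mul_inv_cancel₀ htc
      rw [pow_succ]
      linear_combination (t : ℂ) ^ k * t * this + (t : ℂ) ^ k * u (k + 1) * e
  have hpow : Tendsto (fun k : ℕ => (t : ℂ) ^ k) atTop (𝓝 0) :=
    tendsto_pow_atTop_nhds_zero_of_norm_lt_one (by simpa using ht1)
  have hzero : u 1 - t * u 0 = 0 := by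
    have hl := hpow.mul ((hlim.comp (tendsto_add_atTop_nat 1)).sub (hlim.const_mul (t : ℂ)))
    simp only [Function.comp_def, hv, zero_mul] at hl
    exact tendsto_nhds_unique tendsto_const_nhds hl
  induction k with
  | zero => simp
  | succ k ih =>
    have := hv k
    rw [hzero] at this
    have := (mul_eq_zero.mp this).resolve_left (pow_ne_zero k htc)
    rw [pow_succ, mul_right_comm, ← ih]
    linear_combination this

lemma tendsto_zero_of_summable_norm_sq {u : ℕ → ℂ} (h : Summable fun k => ‖u k‖ ^ 2) :
    Tendsto u atTop (𝓝 0) := by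
  have := h.tendsto_atTop_zero.sqrt
  simp only [Real.sqrt_zero, Real.sqrt_sq (norm_nonneg _)] at this
  exact tendsto_zero_iff_norm_tendsto_zero.mpr this

/-- The sequence equal to `z` at `0`, to `x t ^ n` at `n > 0` and to `y t ^ |n|` at `n < 0`. -/
noncomputable def twoSidedGeom (x y z t : ℝ) (n : ℤ) : ℂ :=
  ((if n = 0 then z else if 0 < n then x else y : ℝ) : ℂ) * (t : ℂ) ^ n.natAbs

section twoSidedGeom

variable (x y z t : ℝ)

lemma twoSidedGeom_zero : twoSidedGeom x y z t 0 = z := by simp [twoSidedGeom]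

lemma twoSidedGeom_pos {k : ℕ} (hk : 0 < k) : twoSidedGeom x y z t k = x * (t : ℂ) ^ k := by
  rw [twoSidedGeom, if_neg (by omega), if_pos (by omega), Int.natAbs_natCast]

lemma twoSidedGeom_neg {k : ℕ} (hk : 0 < k) : twoSidedGeom x y z t (-k) = y * (t : ℂ) ^ k := by
  rw [twoSidedGeom, if_neg (by omega), if_neg (by omega), Int.natAbs_neg, Int.natAbs_natCast]

variable {t} in
lemma summable_twoSidedGeom (ht : |t| < 1) :
    Summable fun n => ‖twoSidedGeom x y z t n‖ ^ 2 := by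
  have hgeom : Summable fun k : ℕ => (|x| + |y| + |z|) ^ 2 * (|t| ^ 2) ^ k :=
    (summable_geometric_of_lt_one (by positivity)
      (pow_lt_one₀ (abs_nonneg t) ht two_ne_zero)).mul_left _
  have hle : ∀ n : ℤ, ‖twoSidedGeom x y z t n‖ ^ 2
      ≤ (|x| + |y| + |z|) ^ 2 * (|t| ^ 2) ^ n.natAbs := by
    intro n
    rw [← pow_mul, mul_comm 2, pow_mul, ← mul_pow, twoSidedGeom, norm_mul, norm_pow,
      Complex.norm_real, Complex.norm_real, Real.norm_eq_abs, Real.norm_eq_abs]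
    gcongr
    have := abs_nonneg x
    have := abs_nonneg y
    have := abs_nonneg z
    split_ifs <;> linarith
  refine summable_int_iff_summable_nat_and_neg.mpr ⟨?_, ?_⟩ <;>
  · refine Summable.of_nonneg_of_le (fun k => by positivity) (fun k => ?_) hgeom
    first
    | simpa using hle k
    | simpa using hle (-k)

end twoSidedGeom

/-- The polynomial whose roots of modulus less than one give the even bound states. -/
def evenPoly (al de si t : ℝ) : ℝ :=
  (t ^ 2 + 2 * si * t + 1) * (de * t + 1) - 2 * (1 + al) ^ 2 * t ^ 2

lemma isEigenvalue_of_coeffs {lam : ℝ} (hlam : lam ≠ 0) {al de si t x y z : ℝ} (ht0 : t ≠ 0)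
    (ht1 : |t| < 1) (hx0 : x ≠ 0) (h0 : (1 + al) * (x + y) * t = (2 * si + (t + t⁻¹)) * z)
    (hx : (1 + al) * z = (de * t + 1) * x) (hy : (1 + al) * z = (de * t + 1) * y) :
    IsEigenvalue lam (al * lam) (2 * lam * (si - al)) (de * lam) (lam * (2 - (t + t⁻¹))) := by
  have htc : (t : ℂ) ≠ 0 := by exact_mod_cast ht0
  have e : (t : ℂ) * (t : ℂ)⁻¹ = 1 := mul_inv_cancel₀ htc
  have p (k : ℕ) : twoSidedGeom x y z t (k + 1) = x * (t : ℂ) ^ (k + 1) :=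
    mod_cast twoSidedGeom_pos x y z t k.succ_pos
  have q (k : ℕ) : twoSidedGeom x y z t (-(k + 1)) = y * (t : ℂ) ^ (k + 1) :=
    mod_cast twoSidedGeom_neg x y z t k.succ_pos
  have p1 : twoSidedGeom x y z t 1 = x * t := by simpa using p 0
  have q1 : twoSidedGeom x y z t (-1) = y * t := by simpa using q 0
  have p2 : twoSidedGeom x y z t 2 = x * (t : ℂ) ^ 2 := mod_cast p 1
  have q2 : twoSidedGeom x y z t (-2) = y * (t : ℂ) ^ 2 := mod_cast q 1
  have h0' : (1 + al : ℂ) * (x + y) * t = (2 * si + (t + (t : ℂ)⁻¹)) * z := by exact_mod_cast h0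
  have hx' : (1 + al : ℂ) * z = (de * t + 1) * x := by exact_mod_cast hx
  have hy' : (1 + al : ℂ) * z = (de * t + 1) * y := by exact_mod_cast hy
  refine ⟨twoSidedGeom x y z t, fun h => ?_, summable_twoSidedGeom x y z ht1,
    (hop_eq_iff hlam al de si (t + t⁻¹) _).mpr ⟨?_, ?_, ?_, fun k => ?_, fun k => ?_⟩⟩
  · have := congrFun h 1
    rw [p1] at this
    simp [hx0, ht0] at this
  · rw [p1, q1, twoSidedGeom_zero]
    push_cast
    linear_combination h0'
  · rw [p1, p2, twoSidedGeom_zero]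
    push_cast
    linear_combination hx' - x * e
  · rw [q1, q2, twoSidedGeom_zero]
    push_cast
    linear_combination hy' - y * e
  · have p3 := p (k + 1)
    have p4 := p (k + 2)
    push_cast at p3 p4
    rw [show (k + 3 : ℤ) = k + 2 + 1 by ring, show (k + 2 : ℤ) = k + 1 + 1 by ring, p3,
      show (k + 1 + 1 + 1 : ℤ) = k + 2 + 1 by ring, p4, p]
    push_cast
    linear_combination -x * (t : ℂ) ^ (k + 1) * e
  · have p3 := q (k + 1)
    have p4 := q (k + 2)
    push_cast at p3 p4
    rw [show (k + 3 : ℤ) = k + 2 + 1 by ring, show (k + 2 : ℤ) = k + 1 + 1 by ring, p3,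
      show (k + 1 + 1 + 1 : ℤ) = k + 2 + 1 by ring, p4, q]
    push_cast
    linear_combination -y * (t : ℂ) ^ (k + 1) * e

lemma isEigenvalue_iff {lam : ℝ} (hlam : lam ≠ 0) {al : ℝ} (hal : al ≠ -1) (de si : ℝ) {t : ℝ}
    (ht0 : t ≠ 0) (ht1 : |t| < 1) :
    IsEigenvalue lam (al * lam) (2 * lam * (si - al)) (de * lam) (lam * (2 - (t + t⁻¹))) ↔
      de * t + 1 = 0 ∨ evenPoly al de si t = 0 := by
  have htc : (t : ℂ) ≠ 0 := by exact_mod_cast ht0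
  have hA : 1 + al ≠ 0 := fun h => hal (by linarith)
  constructor
  · rintro ⟨f, hf0, hsum, hf⟩
    obtain ⟨h0, h1, h2, h3, h4⟩ := (hop_eq_iff hlam al de si (t + t⁻¹) f).mp hf
    have hP := eq_pow_mul_of_recurrence ht0 ht1 (u := fun k => f (k + 1)) (fun k => by
      have := h3 k
      push_cast at this ⊢
      rwa [show (k + 2 + 1 : ℤ) = k + 3 by ring, show (k + 1 + 1 : ℤ) = k + 2 by ring])
      (tendsto_zero_of_summable_norm_sq
        (hsum.comp_injective (i := fun k : ℕ => (k + 1 : ℤ)) fun a b h => by simpa using h))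
    have hN := eq_pow_mul_of_recurrence ht0 ht1 (u := fun k => f (-(k + 1))) (fun k => by
      have := h4 k
      push_cast at this ⊢
      rwa [show (k + 2 + 1 : ℤ) = k + 3 by ring, show (k + 1 + 1 : ℤ) = k + 2 by ring])
      (tendsto_zero_of_summable_norm_sq
        (hsum.comp_injective (i := fun k : ℕ => (-(k + 1) : ℤ)) fun a b h => by simpa using h))
    have e2 : f 2 = t * f 1 := by simpa using hP 1
    have e3 : f (-2) = t * f (-1) := by simpa using hN 1
    have e : (t : ℂ) * (t : ℂ)⁻¹ = 1 := mul_inv_cancel₀ htc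
    push_cast at h0 h1 h2
    have k1 : t * ((1 + al : ℂ) * f 0) = (de * t + 1) * f 1 := by
      linear_combination t * h1 - t * e2 + f 1 * e
    have k2 : t * ((1 + al : ℂ) * f 0) = (de * t + 1) * f (-1) := by
      linear_combination t * h2 - t * e3 + f (-1) * e
    by_cases hd : de * t + 1 = 0
    · exact Or.inl hd
    right
    have hdc : (de * t + 1 : ℂ) ≠ 0 := by exact_mod_cast hd
    have hev : (evenPoly al de si t : ℂ) * f 0 = 0 := by
      unfold evenPoly
      push_cast
      linear_combination -(t : ℂ) * (de * t + 1) * h0 - (1 + al : ℂ) * t * k1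
        - (1 + al : ℂ) * t * k2 - (de * t + 1 : ℂ) * f 0 * e
    rcases mul_eq_zero.mp hev with h | h
    · exact_mod_cast h
    exfalso
    rw [h, mul_zero, mul_zero] at k1 k2
    have f1 := (mul_eq_zero.mp k1.symm).resolve_left hdc
    have f2 := (mul_eq_zero.mp k2.symm).resolve_left hdc
    apply hf0
    funext n
    rcases lt_trichotomy n 0 with hn | rfl | hn
    · obtain ⟨k, rfl⟩ : ∃ k : ℕ, n = -(k + 1) := ⟨(-n - 1).toNat, by omega⟩
      simpa [f2] using hN k
    · exact h
    · obtain ⟨k, rfl⟩ : ∃ k : ℕ, n = k + 1 := ⟨(n - 1).toNat, by omega⟩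
      simpa [f1] using hP k
  · rintro (h | h)
    · exact isEigenvalue_of_coeffs hlam ht0 ht1 (x := 1) (y := -1) (z := 0) one_ne_zero
        (by ring) (by rw [h]; ring) (by rw [h]; ring)
    · refine isEigenvalue_of_coeffs hlam ht0 ht1 (x := 1 + al) (y := 1 + al) (z := de * t + 1) hA
        ?_ (by ring) (by ring)
      unfold evenPoly at h
      field_simp
      linear_combination -h

lemma joukowski_neg {lam t : ℝ} (hlam : 0 < lam) (h0 : 0 < t) (h1 : t < 1) :
    lam * (2 - (t + t⁻¹)) < 0 := by
  have : 2 - (t + t⁻¹) = -((1 - t) ^ 2 / t) := by field_simp; ring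
  rw [this]
  have : 0 < (1 - t) ^ 2 / t := by have := sub_pos.mpr h1; positivity
  nlinarith

lemma four_mul_lt_joukowski {lam t : ℝ} (hlam : 0 < lam) (h0 : -1 < t) (h1 : t < 0) :
    4 * lam < lam * (2 - (t + t⁻¹)) := by
  have := joukowski_neg hlam (t := -t) (by linarith) (by linarith)
  rw [inv_neg] at this
  linarith

/-- The substitution `ν = λ (2 - (t + 1/t))` parametrises the complement of `[0, 4λ]`. -/
lemma notMem_Icc_iff {lam : ℝ} (hlam : 0 < lam) (ν : ℝ) :
    ν ∉ Set.Icc 0 (4 * lam) ↔ ∃ t : ℝ, t ≠ 0 ∧ |t| < 1 ∧ ν = lam * (2 - (t + t⁻¹)) := by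
  constructor
  · have aux (s : ℝ) (hs : 2 < s) : ∃ t : ℝ, 0 < t ∧ t < 1 ∧ t + t⁻¹ = s := by
      have hd : 0 < s ^ 2 - 4 := by nlinarith
      have h0 := Real.sqrt_pos.mpr hd
      have h1 := Real.sq_sqrt hd.le
      set w := √(s ^ 2 - 4)
      have hws : w < s := by nlinarith
      have hws' : s - 2 < w := by nlinarith
      refine ⟨(s - w) / 2, by linarith, by linarith, ?_⟩
      have : s - w ≠ 0 := by linarith
      field_simp
      linear_combination h1
    intro h
    have hs : lam * (ν / lam) = ν := by field_simp
    rcases lt_or_ge ν 0 with hν | hν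
    · obtain ⟨t, h0, h1, ht⟩ := aux (2 - ν / lam) (by linarith [div_neg_of_neg_of_pos hν hlam])
      exact ⟨t, h0.ne', abs_lt.mpr ⟨by linarith, h1⟩, by rw [ht]; linear_combination -hs⟩
    · have hν' : 4 * lam < ν := by
        by_contra! h'
        exact h ⟨hν, h'⟩
      obtain ⟨t, h0, h1, ht⟩ := aux (ν / lam - 2) (by linarith [(lt_div_iff₀ hlam).mpr hν'])
      refine ⟨-t, neg_ne_zero.mpr h0.ne', abs_lt.mpr ⟨by linarith, by linarith⟩, ?_⟩
      rw [inv_neg]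
      linear_combination -hs - lam * ht
  · rintro ⟨t, h0, h1, rfl⟩ ⟨hl, hr⟩
    obtain ⟨h1, h2⟩ := abs_lt.mp h1
    rcases lt_or_gt_of_ne h0 with h | h
    · linarith [four_mul_lt_joukowski hlam h1 h]
    · linarith [joukowski_neg hlam h h2]

lemma joukowski_injective {lam t s : ℝ} (hlam : lam ≠ 0) (ht0 : t ≠ 0) (ht : |t| < 1)
    (hs0 : s ≠ 0) (hs : |s| < 1) (h : lam * (2 - (t + t⁻¹)) = lam * (2 - (s + s⁻¹))) : t = s := by
  have h' := mul_left_cancel₀ hlam h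
  have : (t - s) * (t * s - 1) = 0 := by
    field_simp at h'
    linear_combination -h'
  rcases mul_eq_zero.mp this with h | h
  · linarith
  · have : |t| * |s| < 1 := mul_lt_one_of_nonneg_of_lt_one_left (abs_nonneg t) ht hs.le
    rw [← abs_mul, sub_eq_zero.mp h] at this
    simp at this

lemma discSpec_eq_image {lam : ℝ} (hlam : 0 < lam) {al : ℝ} (hal : al ≠ -1) (de si : ℝ) :
    discSpec lam (al * lam) (2 * lam * (si - al)) (de * lam) =
      (fun t => lam * (2 - (t + t⁻¹))) ''
        {t | t ≠ 0 ∧ |t| < 1 ∧ (de * t + 1 = 0 ∨ evenPoly al de si t = 0)} := by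
  ext ν
  simp only [discSpec, Set.mem_ofPred_eq, Set.mem_image, notMem_Icc_iff hlam]
  constructor
  · rintro ⟨hν, t, h0, h1, rfl⟩
    exact ⟨t, ⟨h0, h1, (isEigenvalue_iff hlam.ne' hal de si h0 h1).mp hν⟩, rfl⟩
  · rintro ⟨t, ⟨h0, h1, h⟩, rfl⟩
    exact ⟨(isEigenvalue_iff hlam.ne' hal de si h0 h1).mpr h, t, h0, h1, rfl⟩

/-- A cubic with three distinct roots is determined by them and its leading coefficient. -/
lemma cubic_eq_of_roots {a b c d p q r : ℝ} (hpq : p ≠ q) (hpr : p ≠ r) (hqr : q ≠ r)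
    (hp : a * p ^ 3 + b * p ^ 2 + c * p + d = 0) (hq : a * q ^ 3 + b * q ^ 2 + c * q + d = 0)
    (hr : a * r ^ 3 + b * r ^ 2 + c * r + d = 0) (x : ℝ) :
    a * x ^ 3 + b * x ^ 2 + c * x + d = a * (x - p) * (x - q) * (x - r) := by
  have e1 : a * (p ^ 2 + p * q + q ^ 2) + b * (p + q) + c = 0 :=
    mul_left_cancel₀ (sub_ne_zero.mpr hpq) (by linear_combination hp - hq)
  have e2 : a * (p ^ 2 + p * r + r ^ 2) + b * (p + r) + c = 0 :=
    mul_left_cancel₀ (sub_ne_zero.mpr hpr) (by linear_combination hp - hr)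
  have e3 : a * (p + q + r) + b = 0 :=
    mul_left_cancel₀ (sub_ne_zero.mpr hqr) (by linear_combination e1 - e2)
  linear_combination hp + (x - p) * e1 + (x - p) * (x - q) * e3

/-- A cubic that is positive at `0` and negative at `±1` has exactly one root in each of `(0, 1)`
and `(-1, 0)`. -/
lemma exists_roots_of_cubic {a b c d : ℝ} (h0 : 0 < d) (h1 : a + b + c + d < 0)
    (hm : -a + b - c + d < 0) :
    ∃ p q : ℝ, 0 < p ∧ p < 1 ∧ -1 < q ∧ q < 0 ∧
      ∀ t, |t| < 1 → (a * t ^ 3 + b * t ^ 2 + c * t + d = 0 ↔ t = p ∨ t = q) := by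
  set g : ℝ → ℝ := fun t => a * t ^ 3 + b * t ^ 2 + c * t + d with hg
  have hcont : Continuous g := by fun_prop
  have g0 : 0 < g 0 := by simpa [hg] using h0
  have g1 : g 1 < 0 := by simpa [hg] using h1
  have gm : g (-1) < 0 := by simp only [hg]; linarith
  obtain ⟨p, ⟨hp0, hp1⟩, hp⟩ := intermediate_value_Ioo' zero_le_one hcont.continuousOn ⟨g1, g0⟩
  obtain ⟨q, ⟨hqm, hq0⟩, hq⟩ :=
    intermediate_value_Ioo (by norm_num : (-1 : ℝ) ≤ 0) hcont.continuousOn ⟨gm, g0⟩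
  refine ⟨p, q, hp0, hp1, hqm, hq0, fun t ht => ⟨fun h => ?_, ?_⟩⟩
  · by_contra! hne
    obtain ⟨htm, ht1⟩ := abs_lt.mp ht
    have key (x : ℝ) : g x = a * (x - t) * (x - p) * (x - q) :=
      cubic_eq_of_roots hne.1 hne.2 (by linarith) h hp hq x
    rw [key] at g0 g1 gm
    have A1 : 0 < (1 - t) * (1 - p) * (1 - q) :=
      mul_pos (mul_pos (by linarith) (by linarith)) (by linarith)
    have Am : 0 < (1 + t) * (1 + p) * (1 + q) :=
      mul_pos (mul_pos (by linarith) (by linarith)) (by linarith)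
    have ha : a < 0 := by
      by_contra! ha
      linarith [mul_nonneg ha A1.le]
    linarith [mul_neg_of_neg_of_pos ha Am]
  · rintro (rfl | rfl) <;> assumption

/-- Theorem 1 e): in the region `U(-,-)`, if `|δ| ≤ 1` the discrete spectrum consists of
exactly two distinct eigenvalues `ν₁ ∈ (-∞, 0)`, `ν₂ ∈ (4λ, ∞)`; if `|δ| > 1` it consists of
exactly three distinct eigenvalues `ν₁ ∈ (-∞, 0)`, `ν₂ ∈ (4λ, ∞)`, `ν₃ = κ`. -/
theorem stmt4 (lam lam1 mu mu1 al de si c1 c2 kap : ℝ)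
    (hlam : 0 < lam)
    (hal : al = lam1 / lam) (hde : de = mu1 / lam) (hsi : si = (2 * lam1 + mu) / (2 * lam))
    (hc1 : c1 = (de - 1) * (si - 1) - (al + 1) ^ 2)
    (hc2 : c2 = (de + 1) * (si + 1) - (al + 1) ^ 2)
    (hkap : kap = (mu1 + lam) ^ 2 / mu1)
    (halne : al ≠ -1)
    (h1 : c1 < 0) (h2 : c2 < 0) :
    (|de| ≤ 1 →
      ∃ ν1 ν2 : ℝ, ν1 < 0 ∧ 4 * lam < ν2 ∧ ν1 ≠ ν2 ∧
        discSpec lam lam1 mu mu1 = {ν1, ν2}) ∧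
    (1 < |de| →
      ∃ ν1 ν2 ν3 : ℝ, ν1 < 0 ∧ 4 * lam < ν2 ∧ ν3 = kap ∧
        ν1 ≠ ν2 ∧ ν1 ≠ ν3 ∧ ν2 ≠ ν3 ∧
        discSpec lam lam1 mu mu1 = {ν1, ν2, ν3}) := by
  have hlam' : lam ≠ 0 := hlam.ne'
  obtain rfl : lam1 = al * lam := by rw [hal]; field_simp
  obtain rfl : mu1 = de * lam := by rw [hde]; field_simp
  obtain rfl : mu = 2 * lam * (si - al) := by rw [hsi]; field_simp; ring
  clear hal hde hsi
  subst hc1 hc2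
  obtain ⟨p, q, hp0, hp1, hqm, hq0, hroots⟩ := exists_roots_of_cubic (a := de)
    (b := 1 + 2 * si * de - 2 * (1 + al) ^ 2) (c := de + 2 * si) (d := 1) one_pos
    (by nlinarith) (by nlinarith)
  have hp1' : |p| < 1 := abs_lt.mpr ⟨by linarith, hp1⟩
  have hq1' : |q| < 1 := abs_lt.mpr ⟨hqm, by linarith⟩
  have heven {t : ℝ} (ht : |t| < 1) : evenPoly al de si t = 0 ↔ t = p ∨ t = q := by
    rw [← hroots t ht, evenPoly]
    ring_nf
  have hν1 := joukowski_neg hlam hp0 hp1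
  have hν2 := four_mul_lt_joukowski hlam hqm hq0
  rw [discSpec_eq_image hlam halne]
  constructor
  · intro hd
    refine ⟨_, _, hν1, hν2, by linarith, ?_⟩
    rw [← Set.image_pair (fun t : ℝ => lam * (2 - (t + t⁻¹)))]
    congr 1
    ext t
    constructor
    · rintro ⟨-, ht, h | h⟩
      · have h' : |de| * |t| < 1 := mul_lt_one_of_nonneg_of_lt_one_right hd (abs_nonneg t) ht
        rw [← abs_mul, eq_neg_of_add_eq_zero_left h] at h'
        simp at h'
      · exact (heven ht).mp h
    · rintro (rfl | rfl)
      · exact ⟨hp0.ne', hp1', Or.inr ((heven hp1').mpr (Or.inl rfl))⟩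
      · exact ⟨hq0.ne, hq1', Or.inr ((heven hq1').mpr (Or.inr rfl))⟩
  · intro hd
    have hde0 : de ≠ 0 := by
      rintro rfl
      norm_num at hd
    set r : ℝ := -de⁻¹ with hr
    have hr0 : r ≠ 0 := by simpa [hr] using hde0
    have hr1 : |r| < 1 := by
      rw [hr, abs_neg, abs_inv]
      exact inv_lt_one_of_one_lt₀ hd
    have hdr (t : ℝ) : de * t + 1 = 0 ↔ t = r := by
      rw [hr]
      constructor
      · intro h
        field_simp
        linear_combination h
      · rintro rfl
        field_simp
        ring
    have hre : evenPoly al de si r ≠ 0 := by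
      rw [evenPoly, (hdr r).mpr rfl]
      have : 1 + al ≠ 0 := fun h => halne (by linarith)
      have : 0 < 2 * (1 + al) ^ 2 * r ^ 2 := by positivity
      linarith
    have hrk : kap = lam * (2 - (r + r⁻¹)) := by
      rw [hkap, hr]
      field_simp
      ring
    refine ⟨_, _, _, hν1, hν2, rfl, by linarith, fun h => ?_, fun h => ?_, ?_⟩
    · rw [hrk] at h
      exact hre ((heven hr1).mpr
        (Or.inl (joukowski_injective hlam' hp0.ne' hp1' hr0 hr1 h).symm))
    · rw [hrk] at h
      exact hre ((heven hr1).mpr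
        (Or.inr (joukowski_injective hlam' hq0.ne hq1' hr0 hr1 h).symm))
    · rw [hrk, ← Set.image_singleton (f := fun t : ℝ => lam * (2 - (t + t⁻¹))),
        ← Set.image_insert_eq (f := fun t : ℝ => lam * (2 - (t + t⁻¹))),
        ← Set.image_insert_eq (f := fun t : ℝ => lam * (2 - (t + t⁻¹)))]
      congr 1
      ext t
      simp only [Set.mem_ofPred_eq, Set.mem_insert_iff, Set.mem_singleton_iff, hdr]
      constructor
      · rintro ⟨-, ht, h | h⟩
        · exact Or.inr (Or.inr h)
        · exact ((heven ht).mp h).imp_right Or.inl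
      · rintro (rfl | rfl | rfl)
        · exact ⟨hp0.ne', hp1', Or.inr ((heven hp1').mpr (Or.inl rfl))⟩
        · exact ⟨hq0.ne, hq1', Or.inr ((heven hq1').mpr (Or.inr rfl))⟩
        · exact ⟨hr0, hr1, Or.inl rfl⟩
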